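/- arXiv:2508.14598 — 2 statements merged into one kernel-verified Lean document; each statement's English description precedes it below -/
import Mathlib

section
/- Let R be a commutative ring, M a group, M⁺ ⊆ M a submonoid, and b0 ∈ M⁺ an element lying in the center of M such that M = M⁺[b0⁻¹]. Let V and W be R-modules equipped with R-linear actions of the monoid M⁺ (i.e. representations of M⁺ on V and W over R), and let M⁺ act diagonally on V ⊗_R W. Then there is an isomorphism of R[M]-modules R[M] ⊗_{R[M⁺]} (V ⊗_R W) ≅ (R[M] ⊗_{R[M⁺]} V) ⊗_R (R[M] ⊗_{R[M⁺]} W), sending m ⊗ (v ⊗ w) to (m ⊗ v) ⊗ (m ⊗ w) for all m ∈ M, v ∈ V, w ∈ W, where M acts diagonally on the right-hand tensor product. -/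
open TensorProduct

noncomputable section

variable (R : Type*) [CommRing R] (M : Type*) [Group M] (Mplus : Submonoid M)

/-- The `R[M]`-submodule of relations defining the induced module
`R[M] ⊗_{R[M⁺]} V` of a representation `ρ` of `M⁺` on `V` over `R`:
it is spanned by the elements `s ⊗ v - 1 ⊗ (s • v)` for `s ∈ M⁺`, `v ∈ V`. -/
def IndRel {V : Type*} [AddCommGroup V] [Module R V]
    (ρ : Representation R ↥Mplus V) :
    Submodule (MonoidAlgebra R M) (MonoidAlgebra R M ⊗[R] V) :=
  Submodule.span (MonoidAlgebra R M)
    {z | ∃ (s : ↥Mplus) (v : V),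
      z = MonoidAlgebra.of R M (s : M) ⊗ₜ[R] v - 1 ⊗ₜ[R] (ρ s v)}

/-- The induced `R[M]`-module `R[M] ⊗_{R[M⁺]} V` of a representation of `M⁺` on `V`
over `R`, realized as the quotient of `R[M] ⊗_R V` by the relations
`(x·s) ⊗ v = x ⊗ (s·v)`. -/
def Ind {V : Type*} [AddCommGroup V] [Module R V]
    (ρ : Representation R ↥Mplus V) :=
  (MonoidAlgebra R M ⊗[R] V) ⧸ IndRel R M Mplus ρ

section Instances

variable {V : Type*} [AddCommGroup V] [Module R V] (ρ : Representation R ↥Mplus V)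

instance : AddCommGroup (Ind R M Mplus ρ) :=
  inferInstanceAs (AddCommGroup ((MonoidAlgebra R M ⊗[R] V) ⧸ IndRel R M Mplus ρ))

instance : Module (MonoidAlgebra R M) (Ind R M Mplus ρ) :=
  inferInstanceAs (Module (MonoidAlgebra R M)
    ((MonoidAlgebra R M ⊗[R] V) ⧸ IndRel R M Mplus ρ))

instance : Module R (Ind R M Mplus ρ) :=
  inferInstanceAs (Module R ((MonoidAlgebra R M ⊗[R] V) ⧸ IndRel R M Mplus ρ))

instance : IsScalarTower R (MonoidAlgebra R M) (Ind R M Mplus ρ) :=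
  inferInstanceAs (IsScalarTower R (MonoidAlgebra R M)
    ((MonoidAlgebra R M ⊗[R] V) ⧸ IndRel R M Mplus ρ))

end Instances

/-- The class of `m ⊗ v` in the induced module `R[M] ⊗_{R[M⁺]} V`. -/
def Ind.mk {V : Type*} [AddCommGroup V] [Module R V]
    (ρ : Representation R ↥Mplus V) (m : M) (v : V) : Ind R M Mplus ρ :=
  Submodule.Quotient.mk (MonoidAlgebra.of R M m ⊗ₜ[R] v)

namespace Ind

variable {R M Mplus}
variable {V : Type*} [AddCommGroup V] [Module R V] {ρ : Representation R ↥Mplus V}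
variable {N : Type*} [AddCommGroup N] [Module R N]

/-- The quotient map `R[M] ⊗_R V → R[M] ⊗_{R[M⁺]} V`, as an `R[M]`-linear map. -/
def mkQ (ρ : Representation R ↥Mplus V) :
    MonoidAlgebra R M ⊗[R] V →ₗ[MonoidAlgebra R M] Ind R M Mplus ρ :=
  (IndRel R M Mplus ρ).mkQ

lemma mkQ_surjective : Function.Surjective (mkQ ρ) :=
  (IndRel R M Mplus ρ).mkQ_surjective

/-- The map `v ↦ m ⊗ v`, as an `R`-linear map. -/
def mkLin (ρ : Representation R ↥Mplus V) (m : M) : V →ₗ[R] Ind R M Mplus ρ :=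
  (mkQ ρ).restrictScalars R ∘ₗ TensorProduct.mk R _ _ (MonoidAlgebra.of R M m)

@[simp]
lemma mkLin_apply (m : M) (v : V) : mkLin ρ m v = mk R M Mplus ρ m v := rfl

lemma of_smul_mk (m m' : M) (v : V) :
    MonoidAlgebra.of R M m • mk R M Mplus ρ m' v = mk R M Mplus ρ (m * m') v := by
  change MonoidAlgebra.of R M m • mkQ ρ _ = mkQ ρ _
  rw [← map_smul, smul_tmul', smul_eq_mul, ← map_mul]

lemma mk_mul (m : M) (s : Mplus) (v : V) :
    mk R M Mplus ρ (m * s) v = mk R M Mplus ρ m (ρ s v) := by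
  have h : mk R M Mplus ρ (s : M) v = mk R M Mplus ρ 1 (ρ s v) := by
    refine (Submodule.Quotient.eq _).2 (Submodule.subset_span ⟨s, v, ?_⟩)
    rw [map_one]
  rw [← of_smul_mk, h, of_smul_mk, mul_one]

lemma hom_ext {f g : Ind R M Mplus ρ →ₗ[R] N}
    (h : ∀ m v, f (mk R M Mplus ρ m v) = g (mk R M Mplus ρ m v)) : f = g := by
  have key : f ∘ₗ (mkQ ρ).restrictScalars R = g ∘ₗ (mkQ ρ).restrictScalars R := by
    refine TensorProduct.ext (MonoidAlgebra.lhom_ext' fun m => ?_)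
    refine LinearMap.ext_ring (LinearMap.ext fun v => ?_)
    exact h m v
  ext x
  obtain ⟨z, rfl⟩ := mkQ_surjective x
  exact LinearMap.congr_fun key z

/-- The map `R[M] ⊗_R V → N` given by a family of linear maps `V → N` indexed by `M`. -/
def preLift (φ : M → V →ₗ[R] N) : MonoidAlgebra R M ⊗[R] V →ₗ[R] N :=
  TensorProduct.lift (Finsupp.lift (V →ₗ[R] N) R M φ ∘ₗ
    (MonoidAlgebra.coeffLinearEquiv R).toLinearMap)

lemma preLift_of_tmul (φ : M → V →ₗ[R] N) (m : M) (v : V) :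
    preLift φ (MonoidAlgebra.of R M m ⊗ₜ v) = φ m v := by
  simp [preLift]

lemma preLift_eq_zero {φ : M → V →ₗ[R] N} (hφ : ∀ m (s : Mplus) v, φ (m * s) v = φ m (ρ s v))
    {z : MonoidAlgebra R M ⊗[R] V} (hz : z ∈ IndRel R M Mplus ρ) : preLift φ z = 0 := by
  suffices ∀ a : MonoidAlgebra R M, preLift φ (a • z) = 0 by simpa using this 1
  induction hz using Submodule.span_induction with
  | mem z hz =>
    obtain ⟨s, v, rfl⟩ := hz
    intro a
    induction a using MonoidAlgebra.induction_on with
    | of m =>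
      rw [smul_sub, smul_tmul', smul_tmul', smul_eq_mul, smul_eq_mul, mul_one, ← map_mul, map_sub,
        preLift_of_tmul, preLift_of_tmul, hφ, sub_self]
    | add a b ha hb => rw [add_smul, map_add, ha, hb, add_zero]
    | smul r a ha => rw [smul_assoc, map_smul, ha, smul_zero]
  | zero => simp
  | add x y _ _ hx hy => intro a; rw [smul_add, map_add, hx, hy, add_zero]
  | smul b x _ hx => intro a; rw [smul_smul, hx]

/-- The universal property of the induced module, in terms of `R`-linear maps. -/
def lift (φ : M → V →ₗ[R] N) (hφ : ∀ m (s : Mplus) v, φ (m * s) v = φ m (ρ s v)) :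
    Ind R M Mplus ρ →ₗ[R] N :=
  ((IndRel R M Mplus ρ).restrictScalars R).liftQ (preLift φ)
    (fun _ hz => preLift_eq_zero hφ hz) ∘ₗ
    (Submodule.Quotient.restrictScalarsEquiv R (IndRel R M Mplus ρ)).symm.toLinearMap

@[simp]
lemma lift_mk (φ : M → V →ₗ[R] N) (hφ : ∀ m (s : Mplus) v, φ (m * s) v = φ m (ρ s v))
    (m : M) (v : V) : lift φ hφ (mk R M Mplus ρ m v) = φ m v :=
  preLift_of_tmul φ m v

variable {W : Type*} [AddCommGroup W] [Module R W]

/-- The comparison map `m ⊗ (v ⊗ w) ↦ (m ⊗ v) ⊗ (m ⊗ w)`. -/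
def tensorHom (ρV : Representation R ↥Mplus V) (ρW : Representation R ↥Mplus W) :
    Ind R M Mplus (ρV.tprod ρW) →ₗ[R] Ind R M Mplus ρV ⊗[R] Ind R M Mplus ρW :=
  lift (fun m => TensorProduct.map (mkLin ρV m) (mkLin ρW m)) fun m s t => by
    induction t with
    | zero => simp
    | add x y hx hy => simp only [map_add, hx, hy]
    | tmul v w => simp [mk_mul]

lemma tensorHom_mk (ρV : Representation R ↥Mplus V) (ρW : Representation R ↥Mplus W)
    (m : M) (v : V) (w : W) :
    tensorHom ρV ρW (mk R M Mplus (ρV.tprod ρW) m (v ⊗ₜ[R] w)) =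
      mk R M Mplus ρV m v ⊗ₜ[R] mk R M Mplus ρW m w := by
  simp [tensorHom]

lemma tensorHom_smul (ρV : Representation R ↥Mplus V) (ρW : Representation R ↥Mplus W)
    (m : M) (x : Ind R M Mplus (ρV.tprod ρW)) :
    tensorHom ρV ρW (MonoidAlgebra.of R M m • x) =
      TensorProduct.map
        (Module.toModuleEnd R (Ind R M Mplus ρV) (MonoidAlgebra.of R M m))
        (Module.toModuleEnd R (Ind R M Mplus ρW) (MonoidAlgebra.of R M m))
        (tensorHom ρV ρW x) := by
  suffices tensorHom ρV ρW ∘ₗ Module.toModuleEnd R _ (MonoidAlgebra.of R M m) =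
      TensorProduct.map
        (Module.toModuleEnd R (Ind R M Mplus ρV) (MonoidAlgebra.of R M m))
        (Module.toModuleEnd R (Ind R M Mplus ρW) (MonoidAlgebra.of R M m)) ∘ₗ
        tensorHom ρV ρW from LinearMap.congr_fun this x
  refine hom_ext fun m' t => ?_
  simp only [LinearMap.comp_apply, Module.toModuleEnd_apply, DistribSMul.toLinearMap_apply,
    of_smul_mk]
  induction t with
  | zero => simp only [← mkLin_apply, map_zero]
  | add x y hx hy => simp only [← mkLin_apply, map_add] at hx hy ⊢; rw [hx, hy]
  | tmul v w =>
    rw [tensorHom_mk, tensorHom_mk, TensorProduct.map_tmul]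
    simp only [DistribSMul.toLinearMap_apply, of_smul_mk]

section Inverse

variable {b : Mplus}

lemma exists_common_denom (hgen : ∀ m : M, ∃ x ∈ Mplus, ∃ n : ℕ, m = x * (b : M)⁻¹ ^ n)
    (m m' : M) : ∃ (x y : Mplus) (n : ℕ), m = x * (b : M)⁻¹ ^ n ∧ m' = y * (b : M)⁻¹ ^ n := by
  obtain ⟨x, hx, n, rfl⟩ := hgen m
  obtain ⟨y, hy, k, rfl⟩ := hgen m'
  refine ⟨⟨x, hx⟩ * b ^ k, ⟨y, hy⟩ * b ^ n, n + k, ?_, ?_⟩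
  · simp [add_comm n k, pow_add, mul_assoc]
  · simp [pow_add, mul_assoc]

variable (ρV : Representation R ↥Mplus V) (ρW : Representation R ↥Mplus W)

/-- Two fractions with numerators `x`, `y` and the common denominator `b ^ n` send `(v, w)`
to `b⁻ⁿ ⊗ (x v ⊗ y w)`. -/
def fracBilin (b x y : Mplus) (n : ℕ) : V →ₗ[R] W →ₗ[R] Ind R M Mplus (ρV.tprod ρW) :=
  ((TensorProduct.mk R V W).compl₁₂ (ρV x) (ρW y)).compr₂
    (mkLin (ρV.tprod ρW) ((b : M)⁻¹ ^ n))

lemma fracBilin_apply (b x y : Mplus) (n : ℕ) (v : V) (w : W) :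
    fracBilin ρV ρW b x y n v w =
      mk R M Mplus (ρV.tprod ρW) ((b : M)⁻¹ ^ n) (ρV x v ⊗ₜ ρW y w) := rfl

lemma fracBilin_mul_pow (x y : Mplus) (n k : ℕ) :
    fracBilin ρV ρW b (b ^ k * x) (b ^ k * y) (n + k) = fracBilin ρV ρW b x y n := by
  ext v w
  have h : (b : M)⁻¹ ^ n = (b : M)⁻¹ ^ (n + k) * (b ^ k : Mplus) := by simp [pow_add]
  rw [fracBilin_apply, fracBilin_apply, h, mk_mul]
  simp

lemma pow_mul_eq (hb : (b : M) ∈ Subgroup.center M) {x x' : Mplus} {n n' : ℕ}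
    (h : (x : M) * (b : M)⁻¹ ^ n = x' * (b : M)⁻¹ ^ n') : b ^ n' * x = b ^ n * x' := by
  have hc (m : M) (k : ℕ) : (b : M) ^ k * m = m * (b : M) ^ k :=
    (Subgroup.mem_center_iff.1 (pow_mem hb k) m).symm
  ext
  push_cast
  calc (b : M) ^ n' * x = (x * (b : M)⁻¹ ^ n) * (b : M) ^ n * (b : M) ^ n' := by simp [hc]
    _ = x' * (b : M)⁻¹ ^ n' * (b : M) ^ n' * (b : M) ^ n := by
      rw [h, mul_assoc, hc, ← mul_assoc]
    _ = (b : M) ^ n * x' := by simp [hc]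

lemma fracBilin_congr (hb : (b : M) ∈ Subgroup.center M) {x y x' y' : Mplus} {n n' : ℕ}
    (hx : (x : M) * (b : M)⁻¹ ^ n = x' * (b : M)⁻¹ ^ n')
    (hy : (y : M) * (b : M)⁻¹ ^ n = y' * (b : M)⁻¹ ^ n') :
    fracBilin ρV ρW b x y n = fracBilin ρV ρW b x' y' n' := by
  rw [← fracBilin_mul_pow ρV ρW x y n n', ← fracBilin_mul_pow ρV ρW x' y' n' n,
    pow_mul_eq hb hx, pow_mul_eq hb hy, add_comm]

/-- There is a family of bilinear maps computing `(m ⊗ v, m' ⊗ w)` through any common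
denominator of `m` and `m'`. -/
lemma exists_bilin (hb : (b : M) ∈ Subgroup.center M)
    (hgen : ∀ m : M, ∃ x ∈ Mplus, ∃ n : ℕ, m = x * (b : M)⁻¹ ^ n) :
    ∃ ψ : M → M → V →ₗ[R] W →ₗ[R] Ind R M Mplus (ρV.tprod ρW), ∀ (x y : Mplus) (n : ℕ),
      ψ (x * (b : M)⁻¹ ^ n) (y * (b : M)⁻¹ ^ n) = fracBilin ρV ρW b x y n := by
  choose x y n hx hy using exists_common_denom hgen
  exact ⟨fun m m' => fracBilin ρV ρW b (x m m') (y m m') (n m m'), fun _ _ _ =>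
    fracBilin_congr ρV ρW hb (hx _ _).symm (hy _ _).symm⟩

lemma exists_tensorInv (hb : (b : M) ∈ Subgroup.center M)
    (hgen : ∀ m : M, ∃ x ∈ Mplus, ∃ n : ℕ, m = x * (b : M)⁻¹ ^ n) :
    ∃ g : Ind R M Mplus ρV ⊗[R] Ind R M Mplus ρW →ₗ[R] Ind R M Mplus (ρV.tprod ρW),
      ∀ (x y : Mplus) (n : ℕ) (v : V) (w : W),
        g (mk R M Mplus ρV (x * (b : M)⁻¹ ^ n) v ⊗ₜ mk R M Mplus ρW (y * (b : M)⁻¹ ^ n) w) =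
          mk R M Mplus (ρV.tprod ρW) ((b : M)⁻¹ ^ n) (ρV x v ⊗ₜ ρW y w) := by
  obtain ⟨ψ, hψ⟩ := exists_bilin ρV ρW hb hgen
  have hmul (x s : Mplus) (n : ℕ) :
      (x : M) * (b : M)⁻¹ ^ n * s = (x * s : Mplus) * (b : M)⁻¹ ^ n := by
    rw [Submonoid.coe_mul, mul_assoc, mul_assoc,
      Subgroup.mem_center_iff.1 (pow_mem (inv_mem hb) n) s]
  have hleft (m m' : M) (s : Mplus) (v : V) : ψ (m * s) m' v = ψ m m' (ρV s v) := by
    obtain ⟨x, y, n, rfl, rfl⟩ := exists_common_denom hgen m m'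
    ext w
    rw [hmul, hψ, hψ, fracBilin_apply, fracBilin_apply, map_mul, Module.End.mul_apply]
  have hright (m m' : M) (s : Mplus) (w : W) :
      (ψ m (m' * s)).flip w = (ψ m m').flip (ρW s w) := by
    obtain ⟨x, y, n, rfl, rfl⟩ := exists_common_denom hgen m m'
    ext v
    rw [hmul, hψ, hψ, LinearMap.flip_apply, LinearMap.flip_apply, fracBilin_apply,
      fracBilin_apply, map_mul, Module.End.mul_apply]
  refine ⟨TensorProduct.lift (lift (fun m => (lift (fun m' => (ψ m m').flip)
    (hright m)).flip) fun m s v => hom_ext fun m' w => ?_), fun x y n v w => ?_⟩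
  · simp [hleft]
  · rw [TensorProduct.lift.tmul, lift_mk, LinearMap.flip_apply, lift_mk, LinearMap.flip_apply, hψ,
      fracBilin_apply]

lemma exists_tensorHom_inverse (hb : (b : M) ∈ Subgroup.center M)
    (hgen : ∀ m : M, ∃ x ∈ Mplus, ∃ n : ℕ, m = x * (b : M)⁻¹ ^ n) :
    ∃ g : Ind R M Mplus ρV ⊗[R] Ind R M Mplus ρW →ₗ[R] Ind R M Mplus (ρV.tprod ρW),
      tensorHom ρV ρW ∘ₗ g = LinearMap.id ∧ g ∘ₗ tensorHom ρV ρW = LinearMap.id := by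
  obtain ⟨g, hg⟩ := exists_tensorInv ρV ρW hb hgen
  have hcomm (x : Mplus) (n : ℕ) : (x : M) * (b : M)⁻¹ ^ n = (b : M)⁻¹ ^ n * x :=
    Subgroup.mem_center_iff.1 (pow_mem (inv_mem hb) n) x
  refine ⟨g, TensorProduct.ext <| hom_ext fun m v => hom_ext fun m' w => ?_,
    hom_ext fun m t => ?_⟩
  · obtain ⟨x, y, n, rfl, rfl⟩ := exists_common_denom hgen m m'
    change tensorHom ρV ρW (g (_ ⊗ₜ _)) = _ ⊗ₜ _
    rw [hg, tensorHom_mk, ← mk_mul, ← mk_mul, hcomm, hcomm]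
  · obtain ⟨x, -, n, rfl, -⟩ := exists_common_denom hgen m m
    rw [LinearMap.comp_apply, LinearMap.id_apply]
    induction t with
    | zero => simp only [← mkLin_apply, map_zero]
    | add t t' h h' => simp only [← mkLin_apply, map_add] at h h' ⊢; rw [h, h']
    | tmul v w =>
      rw [tensorHom_mk, hg, hcomm, mk_mul, Representation.tprod_apply, TensorProduct.map_tmul]

end Inverse

end Ind


/-- Let `R` be a commutative ring, `M` a group, `M⁺ ⊆ M` a submonoid and
`b0 ∈ M⁺` a central element of `M` with `M = M⁺[b0⁻¹]`.  For representations `ρV`, `ρW`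
of `M⁺` on `R`-modules `V`, `W` (with `M⁺` acting diagonally on `V ⊗_R W`), there is an
isomorphism of `R[M]`-modules
`R[M] ⊗_{R[M⁺]} (V ⊗_R W) ≅ (R[M] ⊗_{R[M⁺]} V) ⊗_R (R[M] ⊗_{R[M⁺]} W)`
(the right-hand side carrying the diagonal `M`-action), sending
`m ⊗ (v ⊗ w)` to `(m ⊗ v) ⊗ (m ⊗ w)`. -/
theorem induction_tensor_iso (b0 : M) (hb0 : b0 ∈ Mplus) (hcent : b0 ∈ Subgroup.center M)
    (hgen : ∀ m : M, ∃ x ∈ Mplus, ∃ n : ℕ, m = x * b0⁻¹ ^ n)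
    {V W : Type*} [AddCommGroup V] [Module R V] [AddCommGroup W] [Module R W]
    (ρV : Representation R ↥Mplus V) (ρW : Representation R ↥Mplus W) :
    ∃ e : Ind R M Mplus (ρV.tprod ρW) ≃ₗ[R]
        (Ind R M Mplus ρV ⊗[R] Ind R M Mplus ρW),
      (∀ (m : M) (x : Ind R M Mplus (ρV.tprod ρW)),
        e (MonoidAlgebra.of R M m • x) =
          TensorProduct.map
            (Module.toModuleEnd R (Ind R M Mplus ρV) (MonoidAlgebra.of R M m))
            (Module.toModuleEnd R (Ind R M Mplus ρW) (MonoidAlgebra.of R M m))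
            (e x)) ∧
      ∀ (m : M) (v : V) (w : W),
        e (Ind.mk R M Mplus (ρV.tprod ρW) m (v ⊗ₜ[R] w)) =
          Ind.mk R M Mplus ρV m v ⊗ₜ[R] Ind.mk R M Mplus ρW m w := by
  obtain ⟨g, hfg, hgf⟩ := Ind.exists_tensorHom_inverse (b := ⟨b0, hb0⟩) ρV ρW hcent hgen
  exact ⟨LinearEquiv.ofLinearMap (Ind.tensorHom ρV ρW) g hfg hgf, Ind.tensorHom_smul ρV ρW,
    Ind.tensorHom_mk ρV ρW⟩

end
end

section
/- Let R be a commutative Artinian local ring and S a finitely generated commutative R-algebra. For an S-module V, call an element v ∈ V locally finite if the cyclic S-submodule S·v is finitely generated as an R-module, and let V^{lf} denote the set of locally finite elements. Then: (1) V^{lf} is an S-submodule of V; and (2) if I is an injective S-module, then I^{lf} is an injective S-module. In particular, the inclusion of the category of locally finite S-modules into the category of all S-modules preserves injective objects. -/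
universe u v w

section Smallness

theorem small_of_isFiniteLength {R : Type u} [CommRing R] [IsLocalRing R]
    [Small.{v} (R ⧸ IsLocalRing.maximalIdeal R)] {M : Type w} [AddCommGroup M] [Module R M]
    (h : IsFiniteLength R M) : Small.{v} M := by
  induction h with
  | of_subsingleton => infer_instance
  | @of_simple_quotient M _ _ N _ _ ih =>
    have : Small.{v} (M ⧸ N) := by
      obtain ⟨J, hJ, ⟨e⟩⟩ := isSimpleModule_iff_quot_maximal.mp
        (inferInstance : IsSimpleModule R (M ⧸ N))
      obtain rfl := IsLocalRing.eq_maximalIdeal hJ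
      exact small_of_injective e.injective
    have : Small.{v} (M ⧸ N.toAddSubgroup) := this
    have : Small.{v} N.toAddSubgroup := ih
    exact small_of_injective
      (AddSubgroup.addGroupEquivQuotientProdAddSubgroup (s := N.toAddSubgroup)).injective

theorem small_residue_of_nontrivial_module {R : Type u} [CommRing R] [IsLocalRing R]
    (M : Type v) [AddCommGroup M] [Module R M] [Nontrivial M] :
    Small.{v} (R ⧸ IsLocalRing.maximalIdeal R) := by
  obtain ⟨x, hx⟩ := exists_ne (0 : M)
  have : Small.{v} (R ⧸ Ideal.torsionOf R M x) :=
    small_of_injective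
      (Subtype.val_injective.comp (Ideal.quotTorsionOfEquivSpanSingleton R M x).injective)
  have hle : Ideal.torsionOf R M x ≤ IsLocalRing.maximalIdeal R :=
    IsLocalRing.le_maximalIdeal (by simpa using hx)
  exact small_of_surjective (Ideal.Quotient.factor_surjective hle)

/-- A finite type algebra over an Artinian local ring is no larger than its nonzero modules. -/
theorem small_of_nontrivial_module (R : Type u) [CommRing R] [IsArtinianRing R] [IsLocalRing R]
    (S : Type w) [CommRing S] [Algebra R S] [Algebra.FiniteType R S]
    (M : Type v) [AddCommGroup M] [Module R M] [Nontrivial M] : Small.{v} S := by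
  have := small_residue_of_nontrivial_module (R := R) M
  have : Small.{v} R := small_of_isFiniteLength (R := R)
    (isFiniteLength_iff_isNoetherian_isArtinian.mpr ⟨inferInstance, inferInstance⟩)
  exact Algebra.FiniteType.small (R := R)

end Smallness

theorem Module.Injective.of_subsingleton {S : Type u} [Ring S] {Q : Type v} [AddCommGroup Q]
    [Module S Q] [Subsingleton Q] : Module.Injective S Q where
  out _ _ _ _ _ _ _ _ _ := ⟨0, fun _ => Subsingleton.elim _ _⟩

section LocallyFinite

variable (R : Type u) {S : Type w} [CommRing R] [CommRing S] [Algebra R S]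

section Submodule

variable (S) [IsNoetherianRing R] (V : Type v) [AddCommGroup V] [Module R V] [Module S V]
  [IsScalarTower R S V]

/-- The submodule of elements generating an `S`-submodule which is finite over `R`. -/
def locallyFiniteSubmodule : Submodule S V where
  carrier := {v : V | Module.Finite R (Submodule.span S ({v} : Set V))}
  zero_mem' := by
    rw [Set.mem_ofPred_eq, Submodule.span_zero_singleton]
    infer_instance
  add_mem' {a b} ha hb := by
    have : Module.Finite R (Submodule.span S ({a} : Set V)) := ha
    have : Module.Finite R (Submodule.span S ({b} : Set V)) := hb
    let f : (Submodule.span S ({a} : Set V) × Submodule.span S ({b} : Set V)) →ₗ[R] V :=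
      ((Submodule.subtype _).coprod (Submodule.subtype _)).restrictScalars R
    have hle : (Submodule.span S ({a + b} : Set V)).restrictScalars R ≤ LinearMap.range f := by
      intro x hx
      obtain ⟨c, rfl⟩ := Submodule.mem_span_singleton.mp hx
      exact ⟨(c • ⟨a, Submodule.mem_span_singleton_self a⟩,
        c • ⟨b, Submodule.mem_span_singleton_self b⟩), by simp [f]⟩
    exact Module.Finite.of_injective (Submodule.inclusion hle) (Submodule.inclusion_injective hle)
  smul_mem' c a ha := by
    have : Module.Finite R (Submodule.span S ({a} : Set V)) := ha
    have hle := Submodule.span_singleton_smul_le S c a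
    exact Module.Finite.of_injective ((Submodule.inclusion hle).restrictScalars R)
      (Submodule.inclusion_injective hle)

variable {S V}

theorem mem_locallyFiniteSubmodule {v : V} : v ∈ locallyFiniteSubmodule R S V ↔
    Module.Finite R (Submodule.span S ({v} : Set V)) := Iff.rfl

theorem mem_locallyFiniteSubmodule_of_smul_eq_zero {K : Ideal S} [Module.Finite R (S ⧸ K)] {v : V}
    (hv : ∀ k ∈ K, k • v = 0) : v ∈ locallyFiniteSubmodule R S V := by
  rw [mem_locallyFiniteSubmodule]
  have hle : K ≤ Ideal.torsionOf S V v := fun k hk => hv k hk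
  have : Module.Finite R (S ⧸ Ideal.torsionOf S V v) :=
    Module.Finite.of_surjective (Ideal.Quotient.factorₐ R hle).toLinearMap
      (Ideal.Quotient.factor_surjective hle)
  exact Module.Finite.equiv
    ((Ideal.quotTorsionOfEquivSpanSingleton S V v).restrictScalars R)

theorem finite_quotient_inf {K L : Ideal S} [Module.Finite R (S ⧸ K)] [Module.Finite R (S ⧸ L)] :
    Module.Finite R (S ⧸ K ⊓ L) := by
  let f : (S ⧸ K ⊓ L) →ₗ[R] (S ⧸ K) × (S ⧸ L) :=
    (Ideal.Quotient.factorₐ R inf_le_left).toLinearMap.prod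
      (Ideal.Quotient.factorₐ R inf_le_right).toLinearMap
  refine Module.Finite.of_injective f ((injective_iff_map_eq_zero f).mpr fun x hx => ?_)
  obtain ⟨s, rfl⟩ := Ideal.Quotient.mk_surjective x
  obtain ⟨h₁, h₂⟩ := Prod.ext_iff.mp hx
  exact Ideal.Quotient.eq_zero_iff_mem.mpr
    ⟨Ideal.Quotient.eq_zero_iff_mem.mp h₁, Ideal.Quotient.eq_zero_iff_mem.mp h₂⟩

theorem exists_le_annihilator_finite_quotient {N : Submodule S V} (hN : N.FG)
    (hle : N ≤ locallyFiniteSubmodule R S V) :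
    ∃ K : Ideal S, K ≤ N.annihilator ∧ Module.Finite R (S ⧸ K) := by
  induction N, hN using Submodule.fg_induction with
  | singleton x =>
    have : Module.Finite R (Submodule.span S ({x} : Set V)) :=
      hle (Submodule.mem_span_singleton_self x)
    refine ⟨Ideal.torsionOf S V x, fun k hk => ?_, Module.Finite.equiv
      ((Ideal.quotTorsionOfEquivSpanSingleton S V x).restrictScalars R).symm⟩
    exact (Submodule.mem_annihilator_span_singleton x k).mpr hk
  | sup N₁ N₂ _ _ h₁ h₂ =>
    obtain ⟨K₁, hK₁, _⟩ := h₁ (le_sup_left.trans hle)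
    obtain ⟨K₂, hK₂, _⟩ := h₂ (le_sup_right.trans hle)
    exact ⟨K₁ ⊓ K₂, (inf_le_inf hK₁ hK₂).trans_eq (Submodule.annihilator_sup _ _).symm,
      finite_quotient_inf R⟩

end Submodule

theorem finite_quotient_pow [IsArtinianRing R] [Algebra.FiniteType R S] (K : Ideal S)
    [Module.Finite R (S ⧸ K)] (n : ℕ) : Module.Finite R (S ⧸ K ^ n) := by
  rcases eq_or_ne n 0 with rfl | hn
  · rw [pow_zero, Ideal.one_eq_top]
    infer_instance
  have h := (Module.finite_iff_krullDimLE_zero R (S ⧸ K)).mp inferInstance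
  rw [Module.finite_iff_krullDimLE_zero]
  rwa [Ring.krullDimLE_iff, ringKrullDim_quotient, PrimeSpectrum.zeroLocus_pow _ hn,
    ← ringKrullDim_quotient, ← Ring.krullDimLE_iff]

/-- In a Baer module, a map from an ideal `J` killing `J ⊓ L` is multiplication by an element
killed by `L`. -/
theorem Module.Baer.exists_smul_eq {V : Type v} [AddCommGroup V] [Module S V]
    (hV : Module.Baer S V) {J L : Ideal S} (g : J →ₗ[S] V) (hg : ∀ j : J, (j : S) ∈ L → g j = 0) :
    ∃ x : V, (∀ j : J, (j : S) • x = g j) ∧ ∀ l ∈ L, l • x = 0 := by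
  let f₁ : S →ₗ.[S] V := ⟨J, g⟩
  let f₂ : S →ₗ.[S] V := ⟨L, 0⟩
  have hf : ∀ (x : f₁.domain) (y : f₂.domain), (x : S) = y → f₁ x = f₂ y :=
    fun x y hxy => hg x (hxy ▸ y.2)
  obtain ⟨h, hh⟩ := hV _ (f₁.sup f₂ hf).toFun
  have hsmul (s : S) : s • h 1 = h s := by rw [← map_smul, smul_eq_mul, mul_one]
  refine ⟨h 1, fun j => ?_, fun l hl => ?_⟩
  · rw [hsmul, hh j (Submodule.mem_sup_left j.2)]
    exact ((f₁.left_le_sup f₂ hf).2 (x := j) rfl).symm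
  · rw [hsmul, hh l (Submodule.mem_sup_right hl)]
    exact ((f₁.right_le_sup f₂ hf).2 (x := ⟨l, hl⟩) rfl).symm

theorem Module.Baer.locallyFiniteSubmodule [IsArtinianRing R] [Algebra.FiniteType R S]
    {V : Type v} [AddCommGroup V] [Module R V] [Module S V] [IsScalarTower R S V]
    (hV : Module.Baer S V) : Module.Baer S (locallyFiniteSubmodule R S V) := by
  have : IsNoetherianRing S := Algebra.FiniteType.isNoetherianRing R S
  intro J g
  let g' : J →ₗ[S] V := (_root_.locallyFiniteSubmodule R S V).subtype ∘ₗ g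
  obtain ⟨K, hK, _⟩ := exists_le_annihilator_finite_quotient R (N := LinearMap.range g')
    (by rw [LinearMap.range_eq_map]; exact (IsNoetherian.noetherian (⊤ : Submodule S J)).map g')
    (by rintro _ ⟨j, rfl⟩; exact (g j).2)
  obtain ⟨k, hk⟩ := Ideal.exists_pow_inf_eq_pow_smul K J
  have hle : K ^ (k + 1) ⊓ J ≤ K * J := by
    have := hk (k + 1) k.le_succ
    simp only [smul_eq_mul, Ideal.mul_top, Nat.add_sub_cancel_left, pow_one] at this
    exact this.trans_le (Ideal.mul_mono_right inf_le_right)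
  have hker : K * J ≤ (LinearMap.ker g').map J.subtype := Ideal.mul_le.mpr fun r hr j hj =>
    ⟨r • ⟨j, hj⟩, by
      rw [SetLike.mem_coe, LinearMap.mem_ker, map_smul]
      exact Submodule.mem_annihilator.mp (hK hr) _ ⟨_, rfl⟩, rfl⟩
  obtain ⟨x, hx, hx'⟩ := hV.exists_smul_eq (L := K ^ (k + 1)) g' fun j hj => by
    obtain ⟨j', hj', h⟩ := hker (hle ⟨hj, j.2⟩)
    rwa [Subtype.ext h] at hj'
  have := finite_quotient_pow R K (k + 1)
  exact ⟨LinearMap.toSpanSingleton S _ ⟨x, mem_locallyFiniteSubmodule_of_smul_eq_zero R hx'⟩,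
    fun j hj => Subtype.ext (hx ⟨j, hj⟩)⟩

end LocallyFinite

/-- Let `R` be a commutative Artinian local ring and `S` a finitely
generated commutative `R`-algebra.  For an `S`-module `V` call `v ∈ V` *locally finite*
if the cyclic submodule `S • v` is finitely generated as an `R`-module.  Then:
(1) for any `S`-module `V` the locally finite elements form an `S`-submodule `V^{lf}`; and
(2) if `I` is an injective `S`-module, then any submodule of `I` whose underlying set is
`I^{lf}` is again an injective `S`-module.  In particular the inclusion of locally finite
`S`-modules into all `S`-modules preserves injectives. -/
theorem locally_finite_part_injective {R : Type*} [CommRing R] [IsArtinianRing R]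
    [IsLocalRing R] {S : Type*} [CommRing S] [Algebra R S] [Algebra.FiniteType R S]
    {V : Type*} [AddCommGroup V] [Module R V] [Module S V] [IsScalarTower R S V]
    {I : Type*} [AddCommGroup I] [Module R I] [Module S I] [IsScalarTower R S I]
    (hI : Module.Injective S I) :
    (∃ p : Submodule S V,
      (p : Set V) = {v : V | Module.Finite R ↥(Submodule.span S ({v} : Set V))}) ∧
    (∀ q : Submodule S I,
      (q : Set I) = {x : I | Module.Finite R ↥(Submodule.span S ({x} : Set I))} →
      Module.Injective S ↥q) := by
  refine ⟨⟨locallyFiniteSubmodule R S V, rfl⟩, fun q hq => ?_⟩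
  obtain rfl : q = locallyFiniteSubmodule R S I := SetLike.coe_injective hq
  cases subsingleton_or_nontrivial I with
  | inl _ => exact Module.Injective.of_subsingleton
  | inr _ =>
    have := small_of_nontrivial_module R S I
    exact ((Module.Baer.of_injective hI).locallyFiniteSubmodule R).injective
end
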